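/- Let $a < b$ be positive integers, $d \geq 2$, and define for $k \geq 1$: $I_{d(k-1)+1} = (x^{ak})$ and $I_{d(k-1)+r} = (x^{ak+1}, x^{ak} y^{bk})$ for $r \in \{2,\ldots,d\}$, all in $\mathbb{K}[x,y]$. Then along the subsequence $m = d(k-1)+1$, $\mathrm{reg}(I_m)/m \to a/d$, while along $m = dk$, $\mathrm{reg}(I_m)/m \to (a+b)/d$; since $a/d \neq (a+b)/d$, the limit $\lim_m \mathrm{reg}(I_m)/m$ does not exist. -/

import Mathlib

open MvPolynomial Filter

/-- Regularity of a Borel-fixed monomial ideal, computed as the maximal degree of a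
minimal generator: the least `D` such that the ideal is generated in degrees `≤ D`. -/
noncomputable def idealReg {n : ℕ} {K : Type*} [Field K]
    (I : Ideal (MvPolynomial (Fin n) K)) : ℕ :=
  sInf {D : ℕ | ∃ S : Set (MvPolynomial (Fin n) K),
    I = Ideal.span S ∧ ∀ f ∈ S, f.totalDegree ≤ D}

theorem idealReg_monomial {n : ℕ} {K : Type*} [Field K] (s : Set (Fin n →₀ ℕ))
    (e : Fin n →₀ ℕ) (he : e ∈ s) (hmax : ∀ f ∈ s, f.degree ≤ e.degree)
    (hmin : ∀ f ∈ s, f ≤ e → f = e) :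
    idealReg (Ideal.span ((fun f => monomial f (1 : K)) '' s)) = e.degree := by
  unfold idealReg
  apply le_antisymm
  · apply Nat.sInf_le
    refine ⟨_, rfl, ?_⟩
    rintro _ ⟨f, hf, rfl⟩
    rw [totalDegree_monomial _ one_ne_zero]
    exact hmax f hf
  · apply le_csInf
    · refine ⟨e.degree, _, rfl, ?_⟩
      rintro _ ⟨f, hf, rfl⟩
      rw [totalDegree_monomial _ one_ne_zero]
      exact hmax f hf
    · rintro D ⟨S, hS, hD⟩
      by_contra! hlt
      have h1 : Ideal.span S ≤ Ideal.span ((fun f => monomial f (1 : K)) '' (s \ {e})) := by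
        rw [Ideal.span_le]
        intro f hf
        have hfI : f ∈ Ideal.span ((fun f => monomial f (1 : K)) '' s) := by
          rw [hS]; exact Ideal.subset_span hf
        rw [mem_ideal_span_monomial_image] at hfI
        simp only [SetLike.mem_coe]
        rw [mem_ideal_span_monomial_image]
        intro xi hxi
        obtain ⟨si, hsi, hle⟩ := hfI xi hxi
        refine ⟨si, ⟨hsi, ?_⟩, hle⟩
        rintro rfl
        have h2 : si.degree ≤ xi.degree := Finsupp.degree_mono hle
        have h3 : xi.degree ≤ f.totalDegree := le_totalDegree hxi
        have := hD f hf
        omega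
      rw [← hS] at h1
      have h2 := h1 (Ideal.subset_span ⟨e, he, rfl⟩)
      rw [mem_ideal_span_monomial_image] at h2
      obtain ⟨si, ⟨hsi, hne⟩, hle⟩ := h2 e (by classical simp [support_monomial])
      exact hne (hmin si hsi hle)

theorem reg_one {K : Type*} [Field K] (p : ℕ) :
    idealReg (Ideal.span {(X 0 : MvPolynomial (Fin 2) K) ^ p}) = p := by
  have := idealReg_monomial (K := K) {Finsupp.single (0 : Fin 2) p} (Finsupp.single 0 p)
    rfl (by simp) (by simp)
  simpa [Set.image_singleton, ← X_pow_eq_monomial] using this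

theorem reg_two {K : Type*} [Field K] (p q : ℕ) (hq : 1 ≤ q) :
    idealReg (Ideal.span {(X 0 : MvPolynomial (Fin 2) K) ^ (p + 1), X 0 ^ p * X 1 ^ q})
      = p + q := by
  have := idealReg_monomial (K := K)
    {Finsupp.single (0 : Fin 2) (p + 1), Finsupp.single 0 p + Finsupp.single 1 q}
    (Finsupp.single 0 p + Finsupp.single 1 q)
    (by simp) (by simp [hq]) (by
      intro f hf hle
      rcases hf with rfl | rfl
      · have := hle 0
        simp at this
      · rfl)
  have h2 : monomial (Finsupp.single 0 p + Finsupp.single 1 q) (1 : K)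
      = (X 0 : MvPolynomial (Fin 2) K) ^ p * X 1 ^ q := by
    rw [X_pow_eq_monomial, X_pow_eq_monomial, monomial_mul, one_mul]
  rw [Set.image_pair, h2, ← X_pow_eq_monomial] at this
  simpa using this

/-- For the family `I_{d(k-1)+1} = (x^{ak})`, `I_{d(k-1)+r} = (x^{ak+1}, x^{ak} y^{bk})`
(`2 ≤ r ≤ d`), the normalized regularity tends to `a/d` along `m = d(k-1)+1` and to
`(a+b)/d` along `m = dk`; since `a/d ≠ (a+b)/d`, the limit of `reg(I_m)/m` does not
exist. -/
theorem areg_does_not_exist {K : Type*} [Field K]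
    (a b d : ℕ) (ha : 0 < a) (hab : a < b) (hd : 2 ≤ d)
    (I : ℕ → Ideal (MvPolynomial (Fin 2) K))
    (hI1 : ∀ k : ℕ, 1 ≤ k → I (d * (k - 1) + 1) =
      Ideal.span {(X 0 : MvPolynomial (Fin 2) K) ^ (a * k)})
    (hI2 : ∀ k : ℕ, 1 ≤ k → ∀ r : ℕ, 2 ≤ r → r ≤ d → I (d * (k - 1) + r) =
      Ideal.span {(X 0 : MvPolynomial (Fin 2) K) ^ (a * k + 1),
        X 0 ^ (a * k) * X 1 ^ (b * k)}) :
    Tendsto (fun k : ℕ => (idealReg (I (d * (k - 1) + 1)) : ℝ) / (d * (k - 1) + 1))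
        atTop (nhds ((a : ℝ) / d)) ∧
    Tendsto (fun k : ℕ => (idealReg (I (d * k)) : ℝ) / (d * k))
        atTop (nhds (((a : ℝ) + b) / d)) ∧
    ((a : ℝ) / d ≠ ((a : ℝ) + b) / d) ∧
    ¬ ∃ L : ℝ, Tendsto (fun m : ℕ => (idealReg (I m) : ℝ) / m) atTop (nhds L) := by
  have hd0 : (d : ℝ) ≠ 0 := by positivity
  have hne : (a : ℝ) / d ≠ ((a : ℝ) + b) / d := by
    intro h
    rw [div_left_inj' hd0] at h
    have : (b : ℝ) = 0 := by linarith
    have : b = 0 := by exact_mod_cast this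
    omega
  have t1 : Tendsto (fun k : ℕ => (idealReg (I (d * (k - 1) + 1)) : ℝ) / (d * (k - 1) + 1))
        atTop (nhds ((a : ℝ) / d)) := by
    have h0 : Tendsto (fun k : ℕ => (a : ℝ) / (d + (1 - d) / (k : ℝ))) atTop
        (nhds ((a : ℝ) / (d + 0))) :=
      tendsto_const_nhds.div
        (tendsto_const_nhds.add (tendsto_const_div_atTop_nhds_zero_nat _)) (by simpa using hd0)
    rw [add_zero] at h0
    refine h0.congr' ?_
    filter_upwards [eventually_ge_atTop 1] with k hk
    rw [hI1 k hk, reg_one]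
    have hk0 : (k : ℝ) ≠ 0 := by positivity
    have e : (d : ℝ) * (k - 1) + 1 = (d + (1 - d) / (k : ℝ)) * k := by
      field_simp
      ring
    rw [e]
    push_cast
    rw [mul_div_mul_right _ _ hk0]
  have t2 : Tendsto (fun k : ℕ => (idealReg (I (d * k)) : ℝ) / (d * k))
        atTop (nhds (((a : ℝ) + b) / d)) := by
    refine tendsto_const_nhds.congr' ?_
    filter_upwards [eventually_ge_atTop 1] with k hk
    have hk0 : (k : ℝ) ≠ 0 := by positivity
    have h := hI2 k hk d hd le_rfl
    have e : d * (k - 1) + d = d * k := by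
      obtain ⟨j, rfl⟩ := Nat.exists_eq_add_of_le' hk
      simp [mul_add]
    rw [e] at h
    rw [h, reg_two _ _ (Nat.mul_pos (by omega) hk)]
    push_cast
    rw [← add_mul, mul_div_mul_right _ _ hk0]
  refine ⟨t1, t2, hne, ?_⟩
  rintro ⟨L, hL⟩
  have s1 : Tendsto (fun k : ℕ => d * (k - 1) + 1) atTop atTop := by
    refine tendsto_atTop_mono (fun k => ?_) tendsto_id
    have : 1 * (k - 1) ≤ d * (k - 1) := Nat.mul_le_mul_right _ (by omega)
    simp only [id]
    omega
  have s2 : Tendsto (fun k : ℕ => d * k) atTop atTop :=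
    tendsto_id.const_mul_atTop' (by omega)
  have u1 := hL.comp s1
  have u2 := hL.comp s2
  have e1 : L = (a : ℝ) / d := by
    refine tendsto_nhds_unique (u1.congr' ?_) t1
    filter_upwards [eventually_ge_atTop 1] with k hk
    simp [Nat.cast_sub hk]
  have e2 : L = ((a : ℝ) + b) / d := by
    refine tendsto_nhds_unique (u2.congr' ?_) t2
    filter_upwards with k
    simp
  exact hne (e1.symm.trans e2)
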